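/- Fix α ∈ 𝒜. Under the identification and positivity assumption, for every measurable score g : 𝒳 → ℝ, the excess certified value is bounded by the excess certified hinge risk: V_R̲(d*_R̲) − V_R̲(d_g) ≤ R_h^α(g) − inf_h R_h^α(h), where d*_R̲ is any Bayes-optimal rule for V_R̲, d_g(x) := sgn(g(x)) (sgn(0)=1), and the infimum is over all measurable scores h : 𝒳 → ℝ. -/

import Mathlib

open MeasureTheory ProbabilityTheory Real
open scoped ENNReal

/-- measurable individualized treatment rule with values in `{−1,1}` -/
def IsRule {𝒳 : Type*} [MeasurableSpace 𝒳] (d : 𝒳 → ℤ) : Prop :=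
  Measurable d ∧ ∀ x, d x = 1 ∨ d x = -1

/-- the doubly robust score `Γ_a^α(Z)` -/
noncomputable def Gam {Ω 𝒳 𝒜 : Type*} (X : Ω → 𝒳) (A : Ω → ℤ) (pr : ℤ → 𝒳 → ℝ)
    (ν : ℤ → 𝒳 → 𝒜 → ℝ) (Rl : Ω → ℝ) (a : ℤ) (α : 𝒜) (ω : Ω) : ℝ :=
  ν a (X ω) α + (if A ω = a then (1 : ℝ) else 0) / pr a (X ω) * (Rl ω - ν a (X ω) α)

/-- the certified advantage `D_α(Z) = Γ_1^α(Z) − Γ_{−1}^α(Z)` -/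
noncomputable def Dadv {Ω 𝒳 𝒜 : Type*} (X : Ω → 𝒳) (A : Ω → ℤ) (pr : ℤ → 𝒳 → ℝ)
    (ν : ℤ → 𝒳 → 𝒜 → ℝ) (Rl : Ω → ℝ) (α : 𝒜) (ω : Ω) : ℝ :=
  Gam X A pr ν Rl 1 α ω - Gam X A pr ν Rl (-1) α ω

/-- the certified value `V_R̲(d)` -/
noncomputable def VR {Ω 𝒳 : Type*} [MeasurableSpace Ω] (P : Measure Ω)
    (X : Ω → 𝒳) (A : Ω → ℤ) (pr : ℤ → 𝒳 → ℝ) (Rl : Ω → ℝ) (d : 𝒳 → ℤ) : ℝ :=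
  ∫ ω, Rl ω * (if A ω = d (X ω) then (1 : ℝ) else 0) / pr (A ω) (X ω) ∂P

/-- the certified hinge risk `R_h^α(g) = E[ W_α(Z)·(1 − Y_α(Z)·g(X))₊ ]` -/
noncomputable def hingeRisk {Ω 𝒳 𝒜 : Type*} [MeasurableSpace Ω] (P : Measure Ω)
    (X : Ω → 𝒳) (A : Ω → ℤ) (pr : ℤ → 𝒳 → ℝ)
    (ν : ℤ → 𝒳 → 𝒜 → ℝ) (Rl : Ω → ℝ) (α : 𝒜) (g : 𝒳 → ℝ) : ℝ≥0∞ :=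
  ∫⁻ ω, ENNReal.ofReal (|Dadv X A pr ν Rl α ω|
    * max (1 - (if 0 ≤ Dadv X A pr ν Rl α ω then (1 : ℝ) else -1) * g (X ω)) 0) ∂P

/-- A residual `I - q(X)` with `q(X) = E[I | X]` is orthogonal to bounded functions of `X`. -/
theorem integral_mul_residual_eq_zero {Ω 𝒳 : Type*} [MeasurableSpace Ω] [MeasurableSpace 𝒳]
    {P : Measure Ω} [IsProbabilityMeasure P] {X : Ω → 𝒳} (hX : Measurable X)
    {I : Ω → ℝ} (hI : Integrable I P) {q : 𝒳 → ℝ}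
    (hq : P[I | MeasurableSpace.comap X inferInstance] =ᵐ[P] fun ω => q (X ω))
    {k : 𝒳 → ℝ} (hk : Measurable k) {K : ℝ} (hK : ∀ x, |k x| ≤ K) :
    ∫ ω, k (X ω) * (I ω - q (X ω)) ∂P = 0 := by
  have hm : MeasurableSpace.comap X inferInstance ≤ (inferInstance : MeasurableSpace Ω) :=
    hX.comap_le
  have hkX : AEStronglyMeasurable (fun ω => k (X ω)) P := (hk.comp hX).aestronglyMeasurable
  have hkm : StronglyMeasurable[MeasurableSpace.comap X inferInstance] (fun ω => k (X ω)) :=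
    (hk.comp (comap_measurable X)).stronglyMeasurable
  have hkI : Integrable (fun ω => k (X ω) * I ω) P :=
    hI.bdd_mul hkX (ae_of_all _ fun ω => hK (X ω))
  have hkq : Integrable (fun ω => k (X ω) * q (X ω)) P :=
    (integrable_condExp.congr hq).bdd_mul hkX (ae_of_all _ fun ω => hK (X ω))
  have hpull := condExp_mul_of_stronglyMeasurable_left hkm hkI hI
  have hint : ∫ ω, k (X ω) * I ω ∂P = ∫ ω, k (X ω) * q (X ω) ∂P := by
    rw [← integral_condExp hm]
    refine integral_congr_ae ?_
    filter_upwards [hpull, hq] with ω h1 h2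
    rw [← h2]
    exact h1
  simp_rw [mul_sub]
  rw [integral_sub hkI hkq, hint, sub_self]

/-- Over functions of `X` bounded by one, the correlation with `D` is dominated by the one of
some treatment rule. -/
theorem exists_isRule_integral_mul_le {Ω 𝒳 : Type*} [MeasurableSpace Ω] [MeasurableSpace 𝒳]
    {P : Measure Ω} [IsProbabilityMeasure P] {X : Ω → 𝒳} (hX : Measurable X)
    {D : Ω → ℝ} (hD : Integrable D P) :
    ∃ d : 𝒳 → ℤ, IsRule d ∧ ∀ f : 𝒳 → ℝ, Measurable f → (∀ x, |f x| ≤ 1) →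
      ∫ ω, f (X ω) * D ω ∂P ≤ ∫ ω, (d (X ω) : ℝ) * D ω ∂P := by
  classical
  obtain ⟨φ, hφ, hφX⟩ :=
    (stronglyMeasurable_condExp (m := MeasurableSpace.comap X inferInstance) (μ := P)
      (f := D)).measurable.exists_eq_measurable_comp
  have hq : P[D | MeasurableSpace.comap X inferInstance] =ᵐ[P] fun ω => φ (X ω) :=
    ae_of_all _ fun ω => congrFun hφX ω
  have hφint : Integrable (fun ω => φ (X ω)) P := integrable_condExp.congr hq
  have key : ∀ f : 𝒳 → ℝ, Measurable f → (∀ x, |f x| ≤ 1) →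
      Integrable (fun ω => f (X ω) * φ (X ω)) P ∧
        ∫ ω, f (X ω) * D ω ∂P = ∫ ω, f (X ω) * φ (X ω) ∂P := by
    intro f hf hf1
    have hfX : AEStronglyMeasurable (fun ω => f (X ω)) P := (hf.comp hX).aestronglyMeasurable
    have h1 : Integrable (fun ω => f (X ω) * D ω) P :=
      hD.bdd_mul hfX (ae_of_all _ fun ω => hf1 (X ω))
    have h2 : Integrable (fun ω => f (X ω) * φ (X ω)) P :=
      hφint.bdd_mul hfX (ae_of_all _ fun ω => hf1 (X ω))
    refine ⟨h2, ?_⟩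
    have h0 := integral_mul_residual_eq_zero hX hD hq hf hf1
    simp_rw [mul_sub] at h0
    rw [integral_sub h1 h2] at h0
    exact sub_eq_zero.mp h0
  have hdm : Measurable fun x => if 0 ≤ φ x then (1 : ℤ) else -1 :=
    Measurable.ite (measurableSet_le measurable_const hφ) measurable_const measurable_const
  refine ⟨fun x => if 0 ≤ φ x then 1 else -1, ⟨hdm, fun x => by dsimp only; split_ifs <;> simp⟩, ?_⟩
  intro f hf hf1
  obtain ⟨hi, he⟩ := key f hf hf1
  obtain ⟨hi', he'⟩ := key (fun x => ((if 0 ≤ φ x then (1 : ℤ) else -1 : ℤ) : ℝ))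
    ((measurable_of_countable _).comp hdm) (fun x => by split_ifs <;> simp)
  rw [he, he']
  refine integral_mono hi hi' fun ω => ?_
  have := abs_le.mp (hf1 (X ω))
  dsimp only
  split_ifs with h
  · push_cast; nlinarith
  · push_cast; nlinarith

/-- Projecting the score to `[-1, 1]` linearises the hinge loss from below. -/
theorem abs_sub_mul_clip_le_hinge (D t : ℝ) :
    |D| - max (-1) (min 1 t) * D ≤
      |D| * max (1 - (if 0 ≤ D then (1 : ℝ) else -1) * t) 0 := by
  have hl : min 1 t ≤ max (-1) (min 1 t) := le_max_right _ _
  split_ifs with h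
  · rw [abs_of_nonneg h]
    have : 1 - max (-1) (min 1 t) ≤ max (1 - 1 * t) 0 := by
      rcases le_total 1 t with h1 | h1
      · rw [min_eq_left h1] at *; exact le_max_of_le_right (by linarith)
      · rw [min_eq_right h1] at *; exact le_max_of_le_left (by linarith)
    nlinarith
  · rw [abs_of_neg (not_le.mp h)]
    have : 1 + max (-1) (min 1 t) ≤ max (1 - -1 * t) 0 := by
      rcases le_total (-1) (min 1 t) with h1 | h1
      · rw [max_eq_right h1]; exact le_max_of_le_left (by linarith [min_le_right 1 t])
      · rw [max_eq_left h1]; exact le_max_of_le_right (by linarith)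
    nlinarith [not_le.mp h]

/-- At a score with values in `{-1, 1}` the hinge loss is linear. -/
theorem hinge_eq_abs_sub_mul (D t : ℝ) (ht : t = 1 ∨ t = -1) :
    |D| * max (1 - (if 0 ≤ D then (1 : ℝ) else -1) * t) 0 = |D| - t * D := by
  split_ifs with h
  · rw [abs_of_nonneg h]
    rcases ht with rfl | rfl
    · norm_num
    · norm_num; ring
  · rw [abs_of_neg (not_le.mp h)]
    rcases ht with rfl | rfl
    · norm_num; ring
    · norm_num

section DoublyRobust

variable {Ω 𝒳 𝒜 : Type*} [MeasurableSpace Ω] [MeasurableSpace 𝒳] [MeasurableSpace 𝒜]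
  {P : Measure Ω} [IsProbabilityMeasure P] {X : Ω → 𝒳} {A : Ω → ℤ} {Rl : Ω → ℝ}
  {pr : ℤ → 𝒳 → ℝ} {ε : ℝ} {ν : ℤ → 𝒳 → 𝒜 → ℝ}

theorem measurable_treatment_indicator (hA : Measurable A) (a : ℤ) :
    Measurable fun ω => if A ω = a then (1 : ℝ) else 0 :=
  Measurable.ite (hA (measurableSet_singleton a)) measurable_const measurable_const

theorem integrable_treatment_indicator (hA : Measurable A) (a : ℤ) :
    Integrable (fun ω => if A ω = a then (1 : ℝ) else 0) P :=
  Integrable.of_bound (measurable_treatment_indicator hA a).aestronglyMeasurable 1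
    (ae_of_all _ fun ω => by split_ifs <;> simp)

theorem integrable_Gam (hX : Measurable X) (hA : Measurable A)
    (hRl : Measurable Rl) (hRl01 : ∀ ω, Rl ω ∈ Set.Icc (0 : ℝ) 1)
    (hpr : ∀ a, Measurable (pr a)) (hε : 0 < ε) {a : ℤ} (hprε : ∀ x, ε ≤ pr a x)
    (hν : ∀ a, Measurable fun q : 𝒳 × 𝒜 => ν a q.1 q.2)
    (hν01 : ∀ a x α, ν a x α ∈ Set.Icc (0 : ℝ) 1) (α : 𝒜) :
    Integrable (Gam X A pr ν Rl a α) P := by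
  have hνX : Measurable fun ω => ν a (X ω) α := (hν a).comp (hX.prodMk measurable_const)
  have hprX : Measurable fun ω => pr a (X ω) := (hpr a).comp hX
  have hm : Measurable (Gam X A pr ν Rl a α) :=
    hνX.add (((measurable_treatment_indicator hA a).div hprX).mul (hRl.sub hνX))
  refine Integrable.of_bound hm.aestronglyMeasurable (1 + 1 / ε * 1) (ae_of_all _ fun ω => ?_)
  have h1 := hν01 a (X ω) α
  have h2 := hRl01 ω
  have h3 := hprε (X ω)
  rw [Real.norm_eq_abs, Gam]
  refine (abs_add_le _ _).trans (add_le_add (abs_le.mpr ⟨by linarith [h1.1], h1.2⟩) ?_)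
  rw [abs_mul]
  refine mul_le_mul ?_ (abs_le.mpr ⟨by linarith [h1.2, h2.1], by linarith [h1.1, h2.2]⟩)
    (abs_nonneg _) (by positivity)
  rw [abs_div, abs_of_pos (hε.trans_le h3)]
  refine div_le_div₀ zero_le_one ?_ hε h3
  split_ifs <;> simp

/-- The doubly robust score identifies the certified value of every rule. -/
theorem VR_eq_half_integral (hX : Measurable X)
    (hA : Measurable A) (hA1 : ∀ ω, A ω = 1 ∨ A ω = -1)
    (hRl : Measurable Rl) (hRl01 : ∀ ω, Rl ω ∈ Set.Icc (0 : ℝ) 1)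
    (hpr : ∀ a, Measurable (pr a))
    (hprver : ∀ a ∈ ({1, -1} : Set ℤ),
      (P[(fun ω => if A ω = a then (1 : ℝ) else 0) |
          MeasurableSpace.comap X inferInstance]) =ᵐ[P] fun ω => pr a (X ω))
    (hε : 0 < ε) (hprε : ∀ a ∈ ({1, -1} : Set ℤ), ∀ x, ε ≤ pr a x)
    (hν : ∀ a, Measurable fun q : 𝒳 × 𝒜 => ν a q.1 q.2)
    (hν01 : ∀ a x α, ν a x α ∈ Set.Icc (0 : ℝ) 1) (α : 𝒜) {d : 𝒳 → ℤ} (hd : IsRule d) :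
    VR P X A pr Rl d = (∫ ω, (Gam X A pr ν Rl 1 α ω + Gam X A pr ν Rl (-1) α ω) ∂P) / 2
      + (∫ ω, (d (X ω) : ℝ) * Dadv X A pr ν Rl α ω ∂P) / 2 := by
  classical
  set k : ℤ → 𝒳 → ℝ := fun a x => (if d x = a then (1 : ℝ) else 0) * ν a x α / pr a x with hkdef
  have hkm : ∀ a, Measurable (k a) := fun a =>
    ((measurable_treatment_indicator hd.1 a).mul
      ((hν a).comp (measurable_id.prodMk measurable_const))).div (hpr a)
  have hkb : ∀ a ∈ ({1, -1} : Set ℤ), ∀ x, |k a x| ≤ 1 / ε := by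
    intro a ha x
    have h1 := hν01 a x α
    have h3 := hprε a ha x
    rw [hkdef]
    dsimp only
    rw [abs_div, abs_of_pos (hε.trans_le h3)]
    refine div_le_div₀ zero_le_one ?_ hε h3
    split_ifs
    · rw [one_mul]; exact abs_le.mpr ⟨by linarith [h1.1], h1.2⟩
    · simp
  have hres : ∀ a ∈ ({1, -1} : Set ℤ),
      Integrable (fun ω => k a (X ω) * ((if A ω = a then (1 : ℝ) else 0) - pr a (X ω))) P ∧
      ∫ ω, k a (X ω) * ((if A ω = a then (1 : ℝ) else 0) - pr a (X ω)) ∂P = 0 := by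
    intro a ha
    refine ⟨?_, integral_mul_residual_eq_zero hX (integrable_treatment_indicator hA a)
      (hprver a ha) (hkm a) (hkb a ha)⟩
    exact ((integrable_treatment_indicator hA a).sub
      (integrable_condExp.congr (hprver a ha))).bdd_mul
      ((hkm a).comp hX).aestronglyMeasurable (ae_of_all _ fun ω => hkb a ha (X ω))
  have m1 : (1 : ℤ) ∈ ({1, -1} : Set ℤ) := by simp
  have m2 : (-1 : ℤ) ∈ ({1, -1} : Set ℤ) := by simp
  have hG : ∀ a ∈ ({1, -1} : Set ℤ), Integrable (Gam X A pr ν Rl a α) P := fun a ha =>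
    integrable_Gam hX hA hRl hRl01 hpr hε (hprε a ha) hν hν01 α
  have hS : Integrable (fun ω => Gam X A pr ν Rl 1 α ω + Gam X A pr ν Rl (-1) α ω) P :=
    (hG 1 m1).add (hG (-1) m2)
  have hDd : Integrable (fun ω => (d (X ω) : ℝ) * Dadv X A pr ν Rl α ω) P := by
    refine ((hG 1 m1).sub (hG (-1) m2)).bdd_mul (c := 1)
      ((measurable_of_countable (fun z : ℤ => (z : ℝ))).comp
        (hd.1.comp hX)).aestronglyMeasurable (ae_of_all _ fun ω => ?_)
    rcases hd.2 (X ω) with h | h <;> simp [h]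
  have hpt : ∀ ω, Rl ω * (if A ω = d (X ω) then (1 : ℝ) else 0) / pr (A ω) (X ω)
      = ((Gam X A pr ν Rl 1 α ω + Gam X A pr ν Rl (-1) α ω) / 2
          + (d (X ω) : ℝ) * Dadv X A pr ν Rl α ω / 2)
        + (k 1 (X ω) * ((if A ω = 1 then (1 : ℝ) else 0) - pr 1 (X ω))
          + k (-1) (X ω) * ((if A ω = -1 then (1 : ℝ) else 0) - pr (-1) (X ω))) := by
    intro ω
    have p1 : pr 1 (X ω) ≠ 0 := (hε.trans_le (hprε 1 m1 (X ω))).ne'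
    have p2 : pr (-1) (X ω) ≠ 0 := (hε.trans_le (hprε (-1) m2 (X ω))).ne'
    rcases hA1 ω with h | h <;> rcases hd.2 (X ω) with h' | h' <;>
      simp [hkdef, Dadv, Gam, h, h'] <;> field_simp <;> ring
  unfold VR
  simp_rw [hpt]
  have hmain : Integrable (fun ω => (Gam X A pr ν Rl 1 α ω + Gam X A pr ν Rl (-1) α ω) / 2
      + (d (X ω) : ℝ) * Dadv X A pr ν Rl α ω / 2) P := (hS.div_const 2).add (hDd.div_const 2)
  have hrest : Integrable (fun ω =>
      k 1 (X ω) * ((if A ω = 1 then (1 : ℝ) else 0) - pr 1 (X ω))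
        + k (-1) (X ω) * ((if A ω = -1 then (1 : ℝ) else 0) - pr (-1) (X ω))) P :=
    (hres 1 m1).1.add (hres (-1) m2).1
  rw [integral_add hmain hrest,
    integral_add (hS.div_const 2) (hDd.div_const 2),
    integral_add (hres 1 m1).1 (hres (-1) m2).1, (hres 1 m1).2, (hres (-1) m2).2,
    integral_div, integral_div]
  ring

end DoublyRobust

/-- **Excess-risk domination of the certified hinge loss:**
`V_R̲(d*_R̲) − V_R̲(d_g) ≤ R_h^α(g) − inf_h R_h^α(h)`. -/
theorem certified_hinge_excess_risk_domination
    {Ω 𝒳 𝒜 : Type*} [MeasurableSpace Ω] [MeasurableSpace 𝒳] [MeasurableSpace 𝒜]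
    (P : Measure Ω) [IsProbabilityMeasure P]
    (X : Ω → 𝒳) (hX : Measurable X)
    (A : Ω → ℤ) (hA : Measurable A) (hA1 : ∀ ω, A ω = 1 ∨ A ω = -1)
    (R : Ω → ℝ) (hR : Measurable R) (hR01 : ∀ ω, R ω ∈ Set.Icc (0 : ℝ) 1)
    (Rl : Ω → ℝ) (hRl : Measurable Rl) (hRl01 : ∀ ω, Rl ω ∈ Set.Icc (0 : ℝ) 1)
    (pr : ℤ → 𝒳 → ℝ) (hpr : ∀ a, Measurable (pr a))
    (hprver : ∀ a ∈ ({1, -1} : Set ℤ),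
      (P[(fun ω => if A ω = a then (1 : ℝ) else 0) |
          MeasurableSpace.comap X inferInstance]) =ᵐ[P] fun ω => pr a (X ω))
    (ε : ℝ) (hε : ε ∈ Set.Ioc (0 : ℝ) (1 / 2))
    (hprε : ∀ a ∈ ({1, -1} : Set ℤ), ∀ x, ε ≤ pr a x)
    (ν : ℤ → 𝒳 → 𝒜 → ℝ)
    (hν : ∀ a, Measurable fun q : 𝒳 × 𝒜 => ν a q.1 q.2)
    (hν01 : ∀ a x α, ν a x α ∈ Set.Icc (0 : ℝ) 1)
    -- fix `α`
    (α : 𝒜)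
    -- `d*_R̲` is any Bayes-optimal rule for `V_R̲`
    (dstar : 𝒳 → ℤ) (hdstar : IsRule dstar)
    (hdstarBayes : ∀ d' : 𝒳 → ℤ, IsRule d' → VR P X A pr Rl d' ≤ VR P X A pr Rl dstar)
    -- a measurable score `g`, with induced rule `d_g = sgn(g)` (`sgn 0 = 1`)
    (g : 𝒳 → ℝ) (hg : Measurable g) :
    ENNReal.ofReal
        (VR P X A pr Rl dstar
          - VR P X A pr Rl (fun x => if 0 ≤ g x then 1 else -1))
      ≤ hingeRisk P X A pr ν Rl α g
        - ⨅ h : {h : 𝒳 → ℝ // Measurable h}, hingeRisk P X A pr ν Rl α h.1 := by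
  have hε0 := hε.1
  have m1 : (1 : ℤ) ∈ ({1, -1} : Set ℤ) := by simp
  have m2 : (-1 : ℤ) ∈ ({1, -1} : Set ℤ) := by simp
  have hV := fun (d : 𝒳 → ℤ) (hd : IsRule d) =>
    VR_eq_half_integral hX hA hA1 hRl hRl01 hpr hprver hε0 hprε hν hν01 α hd
  have hDint : Integrable (Dadv X A pr ν Rl α) P :=
    (integrable_Gam hX hA hRl hRl01 hpr hε0 (hprε 1 m1) hν hν01 α).sub
      (integrable_Gam hX hA hRl hRl01 hpr hε0 (hprε (-1) m2) hν hν01 α)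
  have hrule : IsRule fun x => if 0 ≤ g x then (1 : ℤ) else -1 :=
    ⟨Measurable.ite (measurableSet_le measurable_const hg) measurable_const measurable_const,
      fun x => by dsimp only; split_ifs <;> simp⟩
  have hle := hdstarBayes _ hrule
  have hVg := hV _ hrule
  have hVs := hV _ hdstar
  obtain ⟨d', hd', hd'max⟩ := exists_isRule_integral_mul_le hX hDint
  have hVle := hdstarBayes d' hd'
  rw [hV d' hd', hVs] at hVle
  set D := Dadv X A pr ν Rl α with hDdef
  set c : 𝒳 → ℝ := fun x => max (-1) (min 1 (g x)) with hc
  have hcm : Measurable c := measurable_const.max (measurable_const.min hg)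
  have hc1 : ∀ x, |c x| ≤ 1 := fun x =>
    abs_le.mpr ⟨le_max_left _ _, max_le (by norm_num) (min_le_left _ _)⟩
  have hint : ∀ f : 𝒳 → ℝ, Measurable f → (∀ x, |f x| ≤ 1) →
      Integrable (fun ω => f (X ω) * D ω) P := fun f hf hf1 =>
    hDint.bdd_mul (hf.comp hX).aestronglyMeasurable (ae_of_all _ fun ω => hf1 (X ω))
  have hcast : Measurable fun z : ℤ => (z : ℝ) := measurable_of_countable _
  have hruleabs : ∀ d : 𝒳 → ℤ, IsRule d → ∀ x, |(d x : ℝ)| ≤ 1 := by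
    intro d hd x
    rcases hd.2 x with h | h <;> simp [h]
  have hcint := hint c hcm hc1
  have hsint : Integrable (fun ω => (dstar (X ω) : ℝ) * D ω) P :=
    hint _ (hcast.comp hdstar.1) (hruleabs _ hdstar)
  have hgint : Integrable
      (fun ω => ((if 0 ≤ g (X ω) then (1 : ℤ) else -1 : ℤ) : ℝ) * D ω) P :=
    hint _ (hcast.comp hrule.1) (hruleabs _ hrule)
  have hsdiff : Integrable (fun ω => |D ω| - (dstar (X ω) : ℝ) * D ω) P := hDint.abs.sub hsint
  have hreflect := hd'max
    (fun x => 2 * c x - ((if 0 ≤ g x then (1 : ℤ) else -1 : ℤ) : ℝ))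
    ((hcm.const_mul 2).sub (hcast.comp hrule.1)) (fun x => by
      have := abs_le.mp (hc1 x)
      split_ifs with h
      · have : 0 ≤ c x := le_max_of_le_right (le_min zero_le_one h)
        rw [abs_le]; push_cast; constructor <;> linarith
      · have : c x ≤ 0 :=
          max_le (by norm_num) ((min_le_right _ _).trans (not_le.mp h).le)
        rw [abs_le]; push_cast; constructor <;> linarith)
  have hsplit : ∫ ω, (2 * c (X ω) - ((if 0 ≤ g (X ω) then (1 : ℤ) else -1 : ℤ) : ℝ)) * D ω ∂P
      = 2 * (∫ ω, c (X ω) * D ω ∂P)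
        - ∫ ω, ((if 0 ≤ g (X ω) then (1 : ℤ) else -1 : ℤ) : ℝ) * D ω ∂P := by
    simp_rw [sub_mul, mul_assoc]
    rw [integral_sub (hcint.const_mul 2) hgint, integral_const_mul]
  have hstarnn : ∀ ω, 0 ≤ |D ω| - (dstar (X ω) : ℝ) * D ω := fun ω => by
    have h1 := abs_mul (dstar (X ω) : ℝ) (D ω)
    have h2 := hruleabs _ hdstar (X ω)
    have h3 := le_abs_self ((dstar (X ω) : ℝ) * D ω)
    nlinarith [abs_nonneg (D ω)]
  have hcnn : ∀ ω, 0 ≤ |D ω| - c (X ω) * D ω := fun ω => by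
    have h1 := abs_mul (c (X ω)) (D ω)
    have h2 := hc1 (X ω)
    have h3 := le_abs_self (c (X ω) * D ω)
    nlinarith [abs_nonneg (D ω)]
  have hstar : hingeRisk P X A pr ν Rl α (fun x => (dstar x : ℝ))
      = ENNReal.ofReal (∫ ω, (|D ω| - (dstar (X ω) : ℝ) * D ω) ∂P) := by
    rw [ofReal_integral_eq_lintegral_ofReal hsdiff (ae_of_all _ hstarnn)]
    refine lintegral_congr fun ω => ?_
    rw [hinge_eq_abs_sub_mul _ _ ((hdstar.2 (X ω)).imp (fun h => by simp [h]) fun h => by simp [h])]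
  have hinf : ⨅ h : {h : 𝒳 → ℝ // Measurable h}, hingeRisk P X A pr ν Rl α h.1
      ≤ ENNReal.ofReal (∫ ω, (|D ω| - (dstar (X ω) : ℝ) * D ω) ∂P) :=
    hstar ▸ iInf_le (fun h : {h : 𝒳 → ℝ // Measurable h} => hingeRisk P X A pr ν Rl α h.1)
      ⟨_, hcast.comp hdstar.1⟩
  refine ENNReal.le_sub_of_add_le_right (ne_top_of_le_ne_top ENNReal.ofReal_ne_top hinf) ?_
  refine (add_le_add_right hinf _).trans ?_
  rw [← ENNReal.ofReal_add (sub_nonneg.mpr hle) (integral_nonneg hstarnn)]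
  calc _ ≤ ENNReal.ofReal (∫ ω, (|D ω| - c (X ω) * D ω) ∂P) := by
        refine ENNReal.ofReal_le_ofReal ?_
        rw [integral_sub hDint.abs hsint, integral_sub hDint.abs hcint, hVg, hVs]
        linarith
    _ = ∫⁻ ω, ENNReal.ofReal (|D ω| - c (X ω) * D ω) ∂P :=
        ofReal_integral_eq_lintegral_ofReal (hDint.abs.sub hcint) (ae_of_all _ hcnn)
    _ ≤ _ := lintegral_mono fun ω =>
        ENNReal.ofReal_le_ofReal (abs_sub_mul_clip_le_hinge _ _)
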